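/- arXiv:2301.10202 — 6 statements merged into one kernel-verified Lean document; each statement's English description precedes it below -/
import Mathlib

section
/- Let J be the 3×3 real matrix with entries J_{ij} = α·u_i·v_j − (r+μ)·δ_{ij}, where u = (ε₀, ε₁, (1−p_S)ε₂) and v = (1, 1−p_I, 1−p_I), and let R₀ = (α/(r+μ))·[ε₀ + (1−p_I)ε₁ + (1−p_S)(1−p_I)ε₂]. If R₀ < 1, then every (complex) eigenvalue of J has negative real part; if R₀ > 1, then J has a real eigenvalue that is positive. -/
/-- Spectral content of Theorem 2: if `R₀ < 1` every complex eigenvalue of the infected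
Jacobian `J` has negative real part; if `R₀ > 1` then `J` has a positive real eigenvalue. -/
theorem infected_jacobian_stability
    (μ α r pI pS ε₀ ε₁ ε₂ : ℝ)
    (hμ : 0 < μ) (hα : 0 < α) (hr : 0 < r)
    (hpI : 0 < pI ∧ pI < 1) (hpS : 0 < pS ∧ pS < 1)
    (hε₀ : 0 < ε₀) (hε₁ : 0 < ε₁) (hε₂ : 0 < ε₂) (hsum : ε₀ + ε₁ + ε₂ = 1)
    (u v : Fin 3 → ℝ)
    (hu : u = ![ε₀, ε₁, (1 - pS) * ε₂]) (hv : v = ![1, 1 - pI, 1 - pI])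
    (J : Matrix (Fin 3) (Fin 3) ℝ)
    (hJ : ∀ i j, J i j = α * u i * v j - (r + μ) * (if i = j then 1 else 0))
    (R₀ : ℝ)
    (hR₀ : R₀ = (α / (r + μ)) * (ε₀ + (1 - pI) * ε₁ + (1 - pS) * (1 - pI) * ε₂)) :
    (R₀ < 1 → ∀ z : ℂ, z ∈ spectrum ℂ (J.map (Complex.ofReal ·)) → z.re < 0) ∧
      (R₀ > 1 → ∃ x : ℝ, 0 < x ∧ x ∈ spectrum ℝ J) := by
  have hk : 0 < r + μ := by linarith
  set S : ℝ := ε₀ + (1 - pI) * ε₁ + (1 - pS) * (1 - pI) * ε₂ with hS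
  have hR : R₀ * (r + μ) = α * S := by
    rw [hR₀]; field_simp
  constructor
  · intro hlt z hz
    rw [spectrum.mem_iff, Matrix.isUnit_iff_isUnit_det, isUnit_iff_ne_zero, not_not] at hz
    have hd : (z + ((r + μ : ℝ) : ℂ)) ^ 2 * (z + ((r + μ : ℝ) : ℂ) - ((α * S : ℝ) : ℂ)) = 0 := by
      rw [← hz, Matrix.det_fin_three, hS]
      simp [Matrix.algebraMap_matrix_apply, hJ, hu, hv]
      ring
    have hlt' : α * S < r + μ := by nlinarith
    rcases mul_eq_zero.mp hd with h | h
    · have h := congrArg Complex.re (pow_eq_zero_iff (two_ne_zero)|>.mp h)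
      simp only [Complex.add_re, Complex.ofReal_re, Complex.zero_re] at h
      linarith
    · have h := congrArg Complex.re h
      simp only [Complex.add_re, Complex.sub_re, Complex.ofReal_re, Complex.zero_re] at h
      linarith
  · intro hgt
    refine ⟨α * S - (r + μ), by nlinarith, ?_⟩
    rw [spectrum.mem_iff, Matrix.isUnit_iff_isUnit_det, isUnit_iff_ne_zero, not_not]
    have hd : ∀ x : ℝ, (algebraMap ℝ (Matrix (Fin 3) (Fin 3) ℝ) x - J).det
        = (x + (r + μ)) ^ 2 * (x + (r + μ) - α * S) := by
      intro x
      rw [Matrix.det_fin_three, hS]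
      simp [Matrix.algebraMap_matrix_apply, hJ, hu, hv]
      ring
    rw [hd]
    ring
end

section
/- Let n* = Λ/μ, x_i* = ε_iΛ/μ for i = 0,1,2, R₀ = (α/(r+μ))·[ε₀ + (1−p_I)ε₁ + (1−p_S)(1−p_I)ε₂], and let L(x₀,y₀,x₁,y₁,x₂,y₂) = (x₀−x₀*)²/(2x₀*) + y₀ + (1−p_I)[(x₁−x₁*)²/(2x₁*) + y₁] + (1−p_I)[(x₂−x₂*)²/(2x₂*) + y₂]. Let f : ℝ⁶ → ℝ⁶ be the reduced vector field ẋ₀ = ε₀Λ − αx₀Y/n* − μx₀, ẏ₀ = αx₀Y/n* − (r+μ)y₀, ẋ₁ = ε₁Λ − αx₁Y/n* − μx₁, ẏ₁ = αx₁Y/n* − (r+μ)y₁, ẋ₂ = ε₂Λ − α(1−p_S)x₂Y/n* − μx₂, ẏ₂ = α(1−p_S)x₂Y/n* − (r+μ)y₂, where Y = y₀ + (1−p_I)(y₁+y₂). Then for every point with y₀ ≥ 0, y₁ ≥ 0, y₂ ≥ 0, the derivative of L along f (i.e., the inner product of the gradient of L with f) equals −(μ/x₀*)(x₀−x₀*)²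 − (α/(x₀*n*))Y(x₀−x₀*)² − (1−p_I)(μ/x₁*)(x₁−x₁*)² − (1−p_I)(α/(x₁*n*))Y(x₁−x₁*)² − (1−p_I)(μ/x₂*)(x₂−x₂*)² − (1−p_I)(1−p_S)(α/(x₂*n*))Y(x₂−x₂*)² + (r+μ)·Y·(R₀−1). In particular, if R₀ ≤ 1 then this derivative is ≤ 0. -/
/-- Appendix B of the paper: the derivative of the Lyapunov function `L` along the
reduced vector field `f` (the inner product of the gradient of `L` with `f`, i.e.
`fderiv ℝ L p (f p)`) equals the explicit expression of Eq. (B.2); in particular it is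
nonpositive when `R₀ ≤ 1`. Coordinates of `p : Fin 6 → ℝ` are `(x₀,y₀,x₁,y₁,x₂,y₂)`. -/
theorem lyapunov_derivative_along_field
    (Λ μ α r pI pS ε₀ ε₁ ε₂ : ℝ)
    (hΛ : 0 < Λ) (hμ : 0 < μ) (hα : 0 < α) (hr : 0 < r)
    (hpI : 0 < pI ∧ pI < 1) (hpS : 0 < pS ∧ pS < 1)
    (hε₀ : 0 < ε₀) (hε₁ : 0 < ε₁) (hε₂ : 0 < ε₂) (hsum : ε₀ + ε₁ + ε₂ = 1)
    (nstar x₀s x₁s x₂s R₀ : ℝ)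
    (hnstar : nstar = Λ / μ)
    (hx₀s : x₀s = ε₀ * Λ / μ) (hx₁s : x₁s = ε₁ * Λ / μ) (hx₂s : x₂s = ε₂ * Λ / μ)
    (hR₀ : R₀ = (α / (r + μ)) * (ε₀ + (1 - pI) * ε₁ + (1 - pS) * (1 - pI) * ε₂))
    (L : (Fin 6 → ℝ) → ℝ)
    (hL : ∀ p : Fin 6 → ℝ,
      L p = (p 0 - x₀s) ^ 2 / (2 * x₀s) + p 1 +
        (1 - pI) * ((p 2 - x₁s) ^ 2 / (2 * x₁s) + p 3) +
        (1 - pI) * ((p 4 - x₂s) ^ 2 / (2 * x₂s) + p 5))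
    (f : (Fin 6 → ℝ) → (Fin 6 → ℝ))
    (hf : ∀ p : Fin 6 → ℝ, f p =
      ![ε₀ * Λ - α * p 0 * (p 1 + (1 - pI) * (p 3 + p 5)) / nstar - μ * p 0,
        α * p 0 * (p 1 + (1 - pI) * (p 3 + p 5)) / nstar - (r + μ) * p 1,
        ε₁ * Λ - α * p 2 * (p 1 + (1 - pI) * (p 3 + p 5)) / nstar - μ * p 2,
        α * p 2 * (p 1 + (1 - pI) * (p 3 + p 5)) / nstar - (r + μ) * p 3,
        ε₂ * Λ - α * (1 - pS) * p 4 * (p 1 + (1 - pI) * (p 3 + p 5)) / nstar - μ * p 4,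
        α * (1 - pS) * p 4 * (p 1 + (1 - pI) * (p 3 + p 5)) / nstar - (r + μ) * p 5]) :
    ∀ p : Fin 6 → ℝ, 0 ≤ p 1 → 0 ≤ p 3 → 0 ≤ p 5 →
      fderiv ℝ L p (f p) =
        -(μ / x₀s) * (p 0 - x₀s) ^ 2 -
          (α / (x₀s * nstar)) * (p 1 + (1 - pI) * (p 3 + p 5)) * (p 0 - x₀s) ^ 2 -
        (1 - pI) * (μ / x₁s) * (p 2 - x₁s) ^ 2 -
          (1 - pI) * (α / (x₁s * nstar)) * (p 1 + (1 - pI) * (p 3 + p 5)) * (p 2 - x₁s) ^ 2 -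
        (1 - pI) * (μ / x₂s) * (p 4 - x₂s) ^ 2 -
          (1 - pI) * (1 - pS) * (α / (x₂s * nstar)) * (p 1 + (1 - pI) * (p 3 + p 5)) *
            (p 4 - x₂s) ^ 2 +
        (r + μ) * (p 1 + (1 - pI) * (p 3 + p 5)) * (R₀ - 1) ∧
      (R₀ ≤ 1 → fderiv ℝ L p (f p) ≤ 0) := by
  intro p h1 h3 h5
  obtain ⟨hpI0, hpI1⟩ := hpI
  obtain ⟨hpS0, hpS1⟩ := hpS
  have hx0 : 0 < x₀s := by rw [hx₀s]; positivity
  have hx1 : 0 < x₁s := by rw [hx₁s]; positivity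
  have hx2 : 0 < x₂s := by rw [hx₂s]; positivity
  have hn : 0 < nstar := by rw [hnstar]; positivity
  have hq : 0 < 1 - pI := by linarith
  have hs : 0 < 1 - pS := by linarith
  have hder : ∀ v : Fin 6 → ℝ, fderiv ℝ L p v =
      (p 0 - x₀s) / x₀s * v 0 + v 1 + (1 - pI) * ((p 2 - x₁s) / x₁s * v 2 + v 3)
        + (1 - pI) * ((p 4 - x₂s) / x₂s * v 4 + v 5) := by
    intro v
    have ha : ∀ i : Fin 6, HasFDerivAt (fun p : Fin 6 → ℝ => p i)
        (ContinuousLinearMap.proj (R := ℝ) (φ := fun _ : Fin 6 => ℝ) i) p :=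
      fun i => hasFDerivAt_apply i p
    have hsq : ∀ (i : Fin 6) (c : ℝ), HasFDerivAt
        (fun p : Fin 6 → ℝ => (p i - c) ^ 2 * (2 * c)⁻¹) _ p :=
      fun i c => (((ha i).sub_const c).pow 2).mul_const ((2 * c)⁻¹)
    have H := (((hsq 0 x₀s).add (ha 1)).add
      (((hsq 2 x₁s).add (ha 3)).const_mul (1 - pI))).add
      (((hsq 4 x₂s).add (ha 5)).const_mul (1 - pI))
    have H2 := H.congr_of_eventuallyEq (f₁ := L)
      (Filter.Eventually.of_forall fun z => by
        simp only [hL z, div_eq_mul_inv, Pi.add_apply])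
    rw [H2.fderiv]
    simp
    field_simp
  have key : fderiv ℝ L p (f p) =
        -(μ / x₀s) * (p 0 - x₀s) ^ 2 -
          (α / (x₀s * nstar)) * (p 1 + (1 - pI) * (p 3 + p 5)) * (p 0 - x₀s) ^ 2 -
        (1 - pI) * (μ / x₁s) * (p 2 - x₁s) ^ 2 -
          (1 - pI) * (α / (x₁s * nstar)) * (p 1 + (1 - pI) * (p 3 + p 5)) * (p 2 - x₁s) ^ 2 -
        (1 - pI) * (μ / x₂s) * (p 4 - x₂s) ^ 2 -
          (1 - pI) * (1 - pS) * (α / (x₂s * nstar)) * (p 1 + (1 - pI) * (p 3 + p 5)) *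
            (p 4 - x₂s) ^ 2 +
        (r + μ) * (p 1 + (1 - pI) * (p 3 + p 5)) * (R₀ - 1) := by
    have e0 : ε₀ = x₀s / nstar := by rw [hx₀s, hnstar]; field_simp
    have e1 : ε₁ = x₁s / nstar := by rw [hx₁s, hnstar]; field_simp
    have e2 : ε₂ = x₂s / nstar := by rw [hx₂s, hnstar]; field_simp
    have eΛ : Λ = μ * nstar := by rw [hnstar]; field_simp
    have hrm : (r + μ) * R₀ = α * (ε₀ + (1 - pI) * ε₁ + (1 - pS) * (1 - pI) * ε₂) := by
      rw [hR₀]; field_simp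
    have hl : ∀ Y : ℝ, (r + μ) * Y * (R₀ - 1) =
        Y * (α * (ε₀ + (1 - pI) * ε₁ + (1 - pS) * (1 - pI) * ε₂)) - (r + μ) * Y := by
      intro Y; rw [← hrm]; ring
    rw [hder, hl, hf]
    clear hder hl hrm hf hL hR₀ hx₀s hx₁s hx₂s hnstar hsum
    simp only [Matrix.cons_val]
    rw [e0, e1, e2, eΛ]
    field_simp
    ring
  refine ⟨key, fun hR => ?_⟩
  rw [key]
  have hY : 0 ≤ p 1 + (1 - pI) * (p 3 + p 5) := by positivity
  generalize p 1 + (1 - pI) * (p 3 + p 5) = Y at hY ⊢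
  have a1 : 0 ≤ (μ / x₀s) * (p 0 - x₀s) ^ 2 := by positivity
  have a2 : 0 ≤ (α / (x₀s * nstar)) * Y * (p 0 - x₀s) ^ 2 := by positivity
  have a3 : 0 ≤ (1 - pI) * (μ / x₁s) * (p 2 - x₁s) ^ 2 := by positivity
  have a4 : 0 ≤ (1 - pI) * (α / (x₁s * nstar)) * Y * (p 2 - x₁s) ^ 2 := by positivity
  have a5 : 0 ≤ (1 - pI) * (μ / x₂s) * (p 4 - x₂s) ^ 2 := by positivity
  have a6 : 0 ≤ (1 - pI) * (1 - pS) * (α / (x₂s * nstar)) * Y * (p 4 - x₂s) ^ 2 := by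
    positivity
  have a7 : (r + μ) * Y * (R₀ - 1) ≤ 0 :=
    mul_nonpos_of_nonneg_of_nonpos (by positivity) (by linarith)
  linarith
end

section
/- Let n* = Λ/μ and R₀ = (α/(r+μ))·[ε₀ + (1−p_I)ε₁ + (1−p_S)(1−p_I)ε₂]. Suppose (y₀, y₁, y₂) ∈ ℝ³ with Y := y₀ + (1−p_I)(y₁+y₂) ≠ 0 satisfies the equilibrium system: 0 = ε₀Λ − (r+μ)y₀ − μn*(r+μ)y₀/(αY), 0 = ε₁Λ − (r+μ)y₁ − μn*(r+μ)y₁/(αY), 0 = ε₂Λ − (r+μ)y₂ − μn*(r+μ)y₂/(α(1−p_S)Y). Then α·[y₀ + (1−p_I)y₁ + (1−p_S)(1−p_I)y₂] = Λ·(R₀ − 1). In particular, if y₀ > 0, y₁ > 0, and y₂ > 0, then R₀ > 1. -/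
/-- The balance identity of Appendix C: at an endemic equilibrium with `Y ≠ 0`,
`α (y₀ + (1-p_I) y₁ + (1-p_S)(1-p_I) y₂) = Λ (R₀ - 1)`; in particular if all infected
components are positive then `R₀ > 1`. -/
theorem endemic_balance_identity
    (Λ μ α r pI pS ε₀ ε₁ ε₂ : ℝ)
    (hΛ : 0 < Λ) (hμ : 0 < μ) (hα : 0 < α) (hr : 0 < r)
    (hpI : 0 < pI ∧ pI < 1) (hpS : 0 < pS ∧ pS < 1)
    (hε₀ : 0 < ε₀) (hε₁ : 0 < ε₁) (hε₂ : 0 < ε₂) (hsum : ε₀ + ε₁ + ε₂ = 1)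
    (nstar R₀ : ℝ) (hnstar : nstar = Λ / μ)
    (hR₀ : R₀ = (α / (r + μ)) * (ε₀ + (1 - pI) * ε₁ + (1 - pS) * (1 - pI) * ε₂))
    (y₀ y₁ y₂ Y : ℝ) (hY : Y = y₀ + (1 - pI) * (y₁ + y₂)) (hYne : Y ≠ 0)
    (heq0 : 0 = ε₀ * Λ - (r + μ) * y₀ - μ * nstar * (r + μ) * y₀ / (α * Y))
    (heq1 : 0 = ε₁ * Λ - (r + μ) * y₁ - μ * nstar * (r + μ) * y₁ / (α * Y))
    (heq2 : 0 = ε₂ * Λ - (r + μ) * y₂ - μ * nstar * (r + μ) * y₂ / (α * ((1 - pS) * Y))) :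
    α * (y₀ + (1 - pI) * y₁ + (1 - pS) * (1 - pI) * y₂) = Λ * (R₀ - 1) ∧
      (0 < y₀ → 0 < y₁ → 0 < y₂ → 1 < R₀) := by
  have hs : r + μ ≠ 0 := by positivity
  have hα' : α ≠ 0 := hα.ne'
  have hq : 1 - pS ≠ 0 := (sub_pos.mpr hpS.2).ne'
  have hn : μ * nstar = Λ := by rw [hnstar]; field_simp
  rw [hn] at heq0 heq1 heq2
  obtain ⟨k, hk⟩ : ∃ k, k = Λ * (r + μ) / (α * Y) := ⟨_, rfl⟩
  have e0 : Λ * (r + μ) * y₀ / (α * Y) = k * y₀ := by rw [hk]; ring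
  have e1 : Λ * (r + μ) * y₁ / (α * Y) = k * y₁ := by rw [hk]; ring
  have e2 : (1 - pS) * (Λ * (r + μ) * y₂ / (α * ((1 - pS) * Y))) = k * y₂ := by
    rw [hk]; field_simp
  have hkY : α * (k * Y) = Λ * (r + μ) := by rw [hk]; field_simp
  have hR : R₀ * (r + μ) = α * (ε₀ + (1 - pI) * ε₁ + (1 - pS) * (1 - pI) * ε₂) := by
    rw [hR₀]; field_simp
  rw [e0] at heq0
  rw [e1] at heq1
  have main : α * (y₀ + (1 - pI) * y₁ + (1 - pS) * (1 - pI) * y₂) = Λ * (R₀ - 1) := by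
    apply mul_right_cancel₀ hs
    rw [hY] at hkY
    linear_combination α * heq0 + α * (1 - pI) * heq1 + α * (1 - pS) * (1 - pI) * heq2
      - α * (1 - pI) * e2 - hkY - Λ * hR
  refine ⟨main, fun h0 h1 h2 => ?_⟩
  have a : 0 < 1 - pI := sub_pos.mpr hpI.2
  have b : 0 < 1 - pS := sub_pos.mpr hpS.2
  have : 0 < Λ * (R₀ - 1) := by rw [← main]; positivity
  have := (mul_pos_iff_of_pos_left hΛ).mp this
  linarith
end

section
/- Let n* = Λ/μ, R₀ = (α/(r+μ))·[ε₀ + (1−p_I)ε₁ + (1−p_S)(1−p_I)ε₂], and define a = (α/(μn*))·(1−p_S), b = (1−p_S) + (1−R₀) + (α/(r+μ))·p_S·(ε₀ + (1−p_I)ε₁), c = (μn*/α)·(1−R₀). If R₀ > 1, then there exists exactly one Y > 0 with a·Y² + b·Y + c = 0. -/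
theorem quad_aux (a b c : ℝ) (ha : 0 < a) (hc : c < 0) :
    ∃! Y : ℝ, 0 < Y ∧ a * Y ^ 2 + b * Y + c = 0 := by
  have hac : 0 < a * (-c) := mul_pos ha (by linarith)
  have hD : 0 ≤ b ^ 2 - 4 * a * c := by nlinarith [sq_nonneg b]
  have hs := Real.sq_sqrt hD
  have hlt : b < Real.sqrt (b ^ 2 - 4 * a * c) := by
    apply Real.lt_sqrt_of_sq_lt
    nlinarith
  set s := Real.sqrt (b ^ 2 - 4 * a * c) with hsdef
  have hY : 0 < (-b + s) / (2 * a) := div_pos (by linarith) (by linarith)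
  have hE : a * ((-b + s) / (2 * a)) ^ 2 + b * ((-b + s) / (2 * a)) + c = 0 := by
    field_simp
    nlinarith
  refine ⟨(-b + s) / (2 * a), ⟨hY, hE⟩, ?_⟩
  rintro Z ⟨hZ, hZE⟩
  generalize (-b + s) / (2 * a) = Y at hY hE
  by_contra hne
  have h1 : (Z - Y) * (a * (Z + Y) + b) = 0 := by linear_combination hZE - hE
  have h2 : a * (Z + Y) + b = 0 := (mul_eq_zero.mp h1).resolve_left (sub_ne_zero.mpr hne)
  have h3 : c = a * Z * Y := by linear_combination hE - Y * h2
  have h4 : 0 < a * Z * Y := by positivity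
  linarith

/-- Existence and uniqueness of the positive root of the endemic quadratic
`a Y² + b Y + c = 0` (Eq. (C.7)) when `R₀ > 1`. -/
theorem endemic_quadratic_unique_positive_root
    (Λ μ α r pI pS ε₀ ε₁ ε₂ : ℝ)
    (hΛ : 0 < Λ) (hμ : 0 < μ) (hα : 0 < α) (hr : 0 < r)
    (hpI : 0 < pI ∧ pI < 1) (hpS : 0 < pS ∧ pS < 1)
    (hε₀ : 0 < ε₀) (hε₁ : 0 < ε₁) (hε₂ : 0 < ε₂) (hsum : ε₀ + ε₁ + ε₂ = 1)
    (nstar R₀ a b c : ℝ) (hnstar : nstar = Λ / μ)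
    (hR₀ : R₀ = (α / (r + μ)) * (ε₀ + (1 - pI) * ε₁ + (1 - pS) * (1 - pI) * ε₂))
    (ha : a = (α / (μ * nstar)) * (1 - pS))
    (hb : b = (1 - pS) + (1 - R₀) + (α / (r + μ)) * pS * (ε₀ + (1 - pI) * ε₁))
    (hc : c = (μ * nstar / α) * (1 - R₀))
    (hR₀gt : 1 < R₀) :
    ∃! Y : ℝ, 0 < Y ∧ a * Y ^ 2 + b * Y + c = 0 := by
  have hn : 0 < nstar := hnstar ▸ div_pos hΛ hμ
  apply quad_aux
  · rw [ha]
    exact mul_pos (by positivity) (by linarith [hpS.2])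
  · rw [hc]
    exact mul_neg_of_pos_of_neg (by positivity) (by linarith)
end

section
/- Consider the reduced epidemic vector field f on ℝ⁹ (coordinates (x₀,y₀,z₀,x₁,y₁,z₁,x₂,y₂,z₂)) given by: ẋ₀ = ε₀Λ − αx₀Y/n* − μx₀; ẏ₀ = αx₀Y/n* − (r+μ)y₀; ż₀ = ry₀ − μz₀; ẋ₁ = ε₁Λ − αx₁Y/n* − μx₁; ẏ₁ = αx₁Y/n* − (r+μ)y₁; ż₁ = ry₁ − μz₁; ẋ₂ = ε₂Λ − α(1−p_S)x₂Y/n* − μx₂; ẏ₂ = α(1−p_S)x₂Y/n* − (r+μ)y₂; ż₂ = ry₂ − μz₂, where Y = y₀ + (1−p_I)(y₁+y₂) and n* = Λ/μ. If R₀ = (α/(r+μ))·[ε₀ + (1−p_I)ε₁ + (1−p_S)(1−p_I)ε₂] > 1, then there exists exactly one point Ψ** ∈ ℝ⁹ with all nine coordinates strictly positive such that f(Ψ**) = 0. -/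
lemma aux_root (A B q m c : ℝ) (hA : 0 < A) (hB : 0 < B) (hq : 0 < q) (hm : 0 < m) (hc : 0 < c)
    (h : c < (A + B) / m) : ∃ w, 0 < w ∧ A / (w + m) + B / (q * w + m) = c := by
  set W := (A + B / q) / c with hW
  have hWp : 0 < W := by positivity
  have hcont : ContinuousOn (fun w => A / (w + m) + B / (q * w + m)) (Set.Icc 0 W) := by
    apply ContinuousOn.add
    · apply ContinuousOn.div (by fun_prop) (by fun_prop)
      intro x hx
      have := hx.1
      positivity
    · apply ContinuousOn.div (by fun_prop) (by fun_prop)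
      intro x hx
      have := hx.1
      positivity
  have h1 : A / (W + m) < A / W := by
    apply div_lt_div_of_pos_left hA hWp; linarith
  have h2 : B / (q * W + m) < B / (q * W) := by
    apply div_lt_div_of_pos_left hB (by positivity); linarith
  have h3 : A / W + B / (q * W) = c := by
    have : c * W = A + B / q := by rw [hW]; field_simp
    have h4 : A / W + B / (q * W) = (A + B / q) / W := by field_simp
    rw [h4, ← this]; field_simp
  have := intermediate_value_Icc' hWp.le hcont
  obtain ⟨w, hw, hwc⟩ := this (show c ∈ _ from ⟨by linarith, by
    simp only [mul_zero, zero_add]; rw [← add_div]; exact h.le⟩)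
  refine ⟨w, lt_of_le_of_ne hw.1 ?_, hwc⟩
  rintro rfl
  simp only [mul_zero, zero_add] at hwc
  rw [← add_div] at hwc
  linarith

lemma aux_unique (A B q m w v : ℝ) (hA : 0 < A) (hB : 0 < B) (hq : 0 < q) (hm : 0 < m)
    (hw : 0 < w) (h : A / (w + m) + B / (q * w + m) = A / (v + m) + B / (q * v + m))
    (hwv : w < v) : False := by
  have h1 : A / (v + m) < A / (w + m) := by
    apply div_lt_div_of_pos_left hA (by positivity); linarith
  have h2 : B / (q * v + m) < B / (q * w + m) := by
    apply div_lt_div_of_pos_left hB (by positivity); nlinarith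
  linarith

/-- Theorem 4 of the paper: when `R₀ > 1` the reduced epidemic vector field `f` has
exactly one zero with all nine coordinates strictly positive (the endemic equilibrium
`Ψ**`). Coordinates are `(x₀,y₀,z₀,x₁,y₁,z₁,x₂,y₂,z₂)`. -/
theorem endemic_equilibrium_exists_unique
    (Λ μ α r pI pS ε₀ ε₁ ε₂ : ℝ)
    (hΛ : 0 < Λ) (hμ : 0 < μ) (hα : 0 < α) (hr : 0 < r)
    (hpI : 0 < pI ∧ pI < 1) (hpS : 0 < pS ∧ pS < 1)
    (hε₀ : 0 < ε₀) (hε₁ : 0 < ε₁) (hε₂ : 0 < ε₂) (hsum : ε₀ + ε₁ + ε₂ = 1)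
    (nstar R₀ : ℝ) (hnstar : nstar = Λ / μ)
    (hR₀ : R₀ = (α / (r + μ)) * (ε₀ + (1 - pI) * ε₁ + (1 - pS) * (1 - pI) * ε₂))
    (f : (Fin 9 → ℝ) → (Fin 9 → ℝ))
    (hf : ∀ Ψ : Fin 9 → ℝ, f Ψ =
      ![ε₀ * Λ - α * Ψ 0 * (Ψ 1 + (1 - pI) * (Ψ 4 + Ψ 7)) / nstar - μ * Ψ 0,
        α * Ψ 0 * (Ψ 1 + (1 - pI) * (Ψ 4 + Ψ 7)) / nstar - (r + μ) * Ψ 1,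
        r * Ψ 1 - μ * Ψ 2,
        ε₁ * Λ - α * Ψ 3 * (Ψ 1 + (1 - pI) * (Ψ 4 + Ψ 7)) / nstar - μ * Ψ 3,
        α * Ψ 3 * (Ψ 1 + (1 - pI) * (Ψ 4 + Ψ 7)) / nstar - (r + μ) * Ψ 4,
        r * Ψ 4 - μ * Ψ 5,
        ε₂ * Λ - α * (1 - pS) * Ψ 6 * (Ψ 1 + (1 - pI) * (Ψ 4 + Ψ 7)) / nstar - μ * Ψ 6,
        α * (1 - pS) * Ψ 6 * (Ψ 1 + (1 - pI) * (Ψ 4 + Ψ 7)) / nstar - (r + μ) * Ψ 7,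
        r * Ψ 7 - μ * Ψ 8])
    (hR₀gt : 1 < R₀) :
    ∃! Ψ : Fin 9 → ℝ, (∀ i, 0 < Ψ i) ∧ f Ψ = 0 := by
  obtain ⟨_, hpI1⟩ := hpI
  obtain ⟨_, hpS1⟩ := hpS
  obtain ⟨k, hk⟩ : ∃ k, k = 1 - pI := ⟨_, rfl⟩
  obtain ⟨q, hq⟩ : ∃ q, q = 1 - pS := ⟨_, rfl⟩
  rw [← hk, ← hq] at hR₀
  simp only [← hk, ← hq] at hf
  have hkp : 0 < k := by linarith
  have hqp : 0 < q := by linarith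
  have hn : 0 < nstar := by rw [hnstar]; positivity
  have hs : 0 < r + μ := by positivity
  have hA : 0 < ε₀ + k * ε₁ := by positivity
  have hB : 0 < k * q * ε₂ := by positivity
  have hc : (r + μ) / (α * μ) < ((ε₀ + k * ε₁) + k * q * ε₂) / μ := by
    rw [hR₀, div_mul_eq_mul_div, lt_div_iff₀ hs] at hR₀gt
    rw [div_lt_div_iff₀ (by positivity) hμ]
    nlinarith
  obtain ⟨w, hw, hwc⟩ := aux_root _ _ q μ _ hA hB hqp hμ (by positivity) hc
  have key : ∀ Ψ : Fin 9 → ℝ, f Ψ = 0 ↔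
      (ε₀ * Λ - Ψ 0 * (α * (Ψ 1 + k * (Ψ 4 + Ψ 7)) / nstar) - μ * Ψ 0 = 0 ∧
       Ψ 0 * (α * (Ψ 1 + k * (Ψ 4 + Ψ 7)) / nstar) - (r + μ) * Ψ 1 = 0 ∧
       r * Ψ 1 - μ * Ψ 2 = 0 ∧
       ε₁ * Λ - Ψ 3 * (α * (Ψ 1 + k * (Ψ 4 + Ψ 7)) / nstar) - μ * Ψ 3 = 0 ∧
       Ψ 3 * (α * (Ψ 1 + k * (Ψ 4 + Ψ 7)) / nstar) - (r + μ) * Ψ 4 = 0 ∧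
       r * Ψ 4 - μ * Ψ 5 = 0 ∧
       ε₂ * Λ - q * Ψ 6 * (α * (Ψ 1 + k * (Ψ 4 + Ψ 7)) / nstar) - μ * Ψ 6 = 0 ∧
       q * Ψ 6 * (α * (Ψ 1 + k * (Ψ 4 + Ψ 7)) / nstar) - (r + μ) * Ψ 7 = 0 ∧
       r * Ψ 7 - μ * Ψ 8 = 0) := by
    intro Ψ
    have e1 : ∀ x Y : ℝ, α * x * Y / nstar = x * (α * Y / nstar) := by intros; ring
    have e2 : ∀ x Y : ℝ, α * q * x * Y / nstar = q * x * (α * Y / nstar) := by intros; ring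
    rw [hf, funext_iff]
    simp only [e1, e2]
    constructor
    · intro h
      exact ⟨h 0, h 1, h 2, h 3, h 4, h 5, h 6, h 7, h 8⟩
    · rintro ⟨h0, h1, h2, h3, h4, h5, h6, h7, h8⟩ i
      fin_cases i
      exacts [h0, h1, h2, h3, h4, h5, h6, h7, h8]
  have hwp : 0 < w + μ := by positivity
  have hqwp : 0 < q * w + μ := by positivity
  refine ⟨![ε₀ * Λ / (w + μ), ε₀ * Λ / (w + μ) * w / (r + μ),
      r * (ε₀ * Λ / (w + μ) * w / (r + μ)) / μ,
      ε₁ * Λ / (w + μ), ε₁ * Λ / (w + μ) * w / (r + μ),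
      r * (ε₁ * Λ / (w + μ) * w / (r + μ)) / μ,
      ε₂ * Λ / (q * w + μ), q * (ε₂ * Λ / (q * w + μ)) * w / (r + μ),
      r * (q * (ε₂ * Λ / (q * w + μ)) * w / (r + μ)) / μ], ⟨?_, ?_⟩, ?_⟩
  · intro i
    fin_cases i <;> simp <;> positivity
  · rw [key]
    have hY : α * (ε₀ * Λ / (w + μ) * w / (r + μ) + k * (ε₁ * Λ / (w + μ) * w / (r + μ)
        + q * (ε₂ * Λ / (q * w + μ)) * w / (r + μ))) / nstar = w := by
      have : α * (ε₀ * Λ / (w + μ) * w / (r + μ) + k * (ε₁ * Λ / (w + μ) * w / (r + μ)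
        + q * (ε₂ * Λ / (q * w + μ)) * w / (r + μ))) / nstar =
        α * Λ * w / ((r + μ) * nstar) *
          ((ε₀ + k * ε₁) / (w + μ) + k * q * ε₂ / (q * w + μ)) := by
        field_simp
        try ring
      rw [this, hwc, hnstar]
      field_simp
    change ε₀ * Λ - ε₀ * Λ / (w + μ) * (α * (ε₀ * Λ / (w + μ) * w / (r + μ) + k * (ε₁ * Λ / (w + μ) * w / (r + μ)
        + q * (ε₂ * Λ / (q * w + μ)) * w / (r + μ))) / nstar) - μ * (ε₀ * Λ / (w + μ)) = 0 ∧
      ε₀ * Λ / (w + μ) * (α * (ε₀ * Λ / (w + μ) * w / (r + μ) + k * (ε₁ * Λ / (w + μ) * w / (r + μ)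
        + q * (ε₂ * Λ / (q * w + μ)) * w / (r + μ))) / nstar) - (r + μ) * (ε₀ * Λ / (w + μ) * w / (r + μ)) = 0 ∧
      r * (ε₀ * Λ / (w + μ) * w / (r + μ)) - μ * (r * (ε₀ * Λ / (w + μ) * w / (r + μ)) / μ) = 0 ∧
      ε₁ * Λ - ε₁ * Λ / (w + μ) * (α * (ε₀ * Λ / (w + μ) * w / (r + μ) + k * (ε₁ * Λ / (w + μ) * w / (r + μ)
        + q * (ε₂ * Λ / (q * w + μ)) * w / (r + μ))) / nstar) - μ * (ε₁ * Λ / (w + μ)) = 0 ∧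
      ε₁ * Λ / (w + μ) * (α * (ε₀ * Λ / (w + μ) * w / (r + μ) + k * (ε₁ * Λ / (w + μ) * w / (r + μ)
        + q * (ε₂ * Λ / (q * w + μ)) * w / (r + μ))) / nstar) - (r + μ) * (ε₁ * Λ / (w + μ) * w / (r + μ)) = 0 ∧
      r * (ε₁ * Λ / (w + μ) * w / (r + μ)) - μ * (r * (ε₁ * Λ / (w + μ) * w / (r + μ)) / μ) = 0 ∧
      ε₂ * Λ - q * (ε₂ * Λ / (q * w + μ)) * (α * (ε₀ * Λ / (w + μ) * w / (r + μ) + k * (ε₁ * Λ / (w + μ) * w / (r + μ)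
        + q * (ε₂ * Λ / (q * w + μ)) * w / (r + μ))) / nstar) - μ * (ε₂ * Λ / (q * w + μ)) = 0 ∧
      q * (ε₂ * Λ / (q * w + μ)) * (α * (ε₀ * Λ / (w + μ) * w / (r + μ) + k * (ε₁ * Λ / (w + μ) * w / (r + μ)
        + q * (ε₂ * Λ / (q * w + μ)) * w / (r + μ))) / nstar) - (r + μ) * (q * (ε₂ * Λ / (q * w + μ)) * w / (r + μ)) = 0 ∧
      r * (q * (ε₂ * Λ / (q * w + μ)) * w / (r + μ)) - μ * (r * (q * (ε₂ * Λ / (q * w + μ)) * w / (r + μ)) / μ) = 0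
    rw [hY]
    refine ⟨?_, ?_, ?_, ?_, ?_, ?_, ?_, ?_, ?_⟩ <;> field_simp <;> ring
  · rintro Ψ ⟨hpos, hz⟩
    rw [key] at hz
    obtain ⟨v, hv⟩ : ∃ v, v = α * (Ψ 1 + k * (Ψ 4 + Ψ 7)) / nstar := ⟨_, rfl⟩
    rw [← hv] at hz
    obtain ⟨h0, h1, h2, h3, h4, h5, h6, h7, h8⟩ := hz
    have hvp : 0 < v := by
      have := hpos 1
      have := hpos 4
      have := hpos 7
      rw [hv]; positivity
    have g0 : Ψ 0 = ε₀ * Λ / (v + μ) := by rw [eq_div_iff (by positivity)]; linarith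
    have g3 : Ψ 3 = ε₁ * Λ / (v + μ) := by rw [eq_div_iff (by positivity)]; linarith
    have g6 : Ψ 6 = ε₂ * Λ / (q * v + μ) := by rw [eq_div_iff (by positivity)]; linarith
    have g1 : Ψ 1 = Ψ 0 * v / (r + μ) := by rw [eq_div_iff (by positivity)]; linarith
    have g4 : Ψ 4 = Ψ 3 * v / (r + μ) := by rw [eq_div_iff (by positivity)]; linarith
    have g7 : Ψ 7 = q * Ψ 6 * v / (r + μ) := by rw [eq_div_iff (by positivity)]; linarith
    have g2 : Ψ 2 = r * Ψ 1 / μ := by rw [eq_div_iff (by positivity)]; linarith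
    have g5 : Ψ 5 = r * Ψ 4 / μ := by rw [eq_div_iff (by positivity)]; linarith
    have g8 : Ψ 8 = r * Ψ 7 / μ := by rw [eq_div_iff (by positivity)]; linarith
    have hvc : (ε₀ + k * ε₁) / (v + μ) + k * q * ε₂ / (q * v + μ) = (r + μ) / (α * μ) := by
      have e : v = α * Λ * v / ((r + μ) * nstar) *
          ((ε₀ + k * ε₁) / (v + μ) + k * q * ε₂ / (q * v + μ)) := by
        conv_lhs => rw [hv, g1, g4, g7, g0, g3, g6]
        have : 0 < q * v + μ := by positivity
        field_simp
        try ring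
      generalize (ε₀ + k * ε₁) / (v + μ) + k * q * ε₂ / (q * v + μ) = X at e
      rw [hnstar] at e
      field_simp at e ⊢
      linarith
    have hvw : v = w := by
      rcases lt_trichotomy v w with h | h | h
      · exact (aux_unique _ _ q μ v w hA hB hqp hμ hvp (hvc.trans hwc.symm) h).elim
      · exact h
      · exact (aux_unique _ _ q μ w v hA hB hqp hμ hw (hwc.trans hvc.symm) h).elim
    rw [hvw] at g0 g1 g3 g4 g6 g7
    rw [g0] at g1
    rw [g3] at g4
    rw [g6] at g7
    rw [g1] at g2
    rw [g4] at g5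
    rw [g7] at g8
    funext i
    fin_cases i
    exacts [g0, g1, g2, g3, g4, g5, g6, g7, g8]
end

section
/- Consider the reduced epidemic vector field f on ℝ⁹ defined by ẋ₀ = ε₀Λ − αx₀Y/n* − μx₀, ẏ₀ = αx₀Y/n* − (r+μ)y₀, ż₀ = ry₀ − μz₀, ẋ₁ = ε₁Λ − αx₁Y/n* − μx₁, ẏ₁ = αx₁Y/n* − (r+μ)y₁, ż₁ = ry₁ − μz₁, ẋ₂ = ε₂Λ − α(1−p_S)x₂Y/n* − μx₂, ẏ₂ = α(1−p_S)x₂Y/n* − (r+μ)y₂, ż₂ = ry₂ − μz₂, where Y = y₀ + (1−p_I)(y₁+y₂) and n* = Λ/μ. If R₀ = (α/(r+μ))·[ε₀ + (1−p_I)ε₁ + (1−p_S)(1−p_I)ε₂] < 1, then f has no zero with y₀ > 0, y₁ > 0, and y₂ > 0. -/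
/-- Nonexistence of an endemic equilibrium when `R₀ < 1`: the reduced epidemic vector
field `f` has no zero with `y₀ > 0`, `y₁ > 0`, `y₂ > 0` (coordinates
`(x₀,y₀,z₀,x₁,y₁,z₁,x₂,y₂,z₂)`, the `y`'s at positions 1, 4, 7). -/
theorem no_endemic_equilibrium_below_threshold
    (Λ μ α r pI pS ε₀ ε₁ ε₂ : ℝ)
    (hΛ : 0 < Λ) (hμ : 0 < μ) (hα : 0 < α) (hr : 0 < r)
    (hpI : 0 < pI ∧ pI < 1) (hpS : 0 < pS ∧ pS < 1)
    (hε₀ : 0 < ε₀) (hε₁ : 0 < ε₁) (hε₂ : 0 < ε₂) (hsum : ε₀ + ε₁ + ε₂ = 1)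
    (nstar R₀ : ℝ) (hnstar : nstar = Λ / μ)
    (hR₀ : R₀ = (α / (r + μ)) * (ε₀ + (1 - pI) * ε₁ + (1 - pS) * (1 - pI) * ε₂))
    (f : (Fin 9 → ℝ) → (Fin 9 → ℝ))
    (hf : ∀ Ψ : Fin 9 → ℝ, f Ψ =
      ![ε₀ * Λ - α * Ψ 0 * (Ψ 1 + (1 - pI) * (Ψ 4 + Ψ 7)) / nstar - μ * Ψ 0,
        α * Ψ 0 * (Ψ 1 + (1 - pI) * (Ψ 4 + Ψ 7)) / nstar - (r + μ) * Ψ 1,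
        r * Ψ 1 - μ * Ψ 2,
        ε₁ * Λ - α * Ψ 3 * (Ψ 1 + (1 - pI) * (Ψ 4 + Ψ 7)) / nstar - μ * Ψ 3,
        α * Ψ 3 * (Ψ 1 + (1 - pI) * (Ψ 4 + Ψ 7)) / nstar - (r + μ) * Ψ 4,
        r * Ψ 4 - μ * Ψ 5,
        ε₂ * Λ - α * (1 - pS) * Ψ 6 * (Ψ 1 + (1 - pI) * (Ψ 4 + Ψ 7)) / nstar - μ * Ψ 6,
        α * (1 - pS) * Ψ 6 * (Ψ 1 + (1 - pI) * (Ψ 4 + Ψ 7)) / nstar - (r + μ) * Ψ 7,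
        r * Ψ 7 - μ * Ψ 8])
    (hR₀lt : R₀ < 1) :
    ¬∃ Ψ : Fin 9 → ℝ, 0 < Ψ 1 ∧ 0 < Ψ 4 ∧ 0 < Ψ 7 ∧ f Ψ = 0 := by
  rintro ⟨Ψ, h1, h4, h7, h⟩
  rw [hf] at h
  have e0 := congrFun h 0
  have e1 := congrFun h 1
  have e3 := congrFun h 3
  have e4 := congrFun h 4
  have e6 := congrFun h 6
  have e7 := congrFun h 7
  simp only [Pi.zero_apply] at e0 e1 e3 e4 e6 e7
  change ε₀ * Λ - α * Ψ 0 * (Ψ 1 + (1 - pI) * (Ψ 4 + Ψ 7)) / nstar - μ * Ψ 0 = 0 at e0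
  change α * Ψ 0 * (Ψ 1 + (1 - pI) * (Ψ 4 + Ψ 7)) / nstar - (r + μ) * Ψ 1 = 0 at e1
  change ε₁ * Λ - α * Ψ 3 * (Ψ 1 + (1 - pI) * (Ψ 4 + Ψ 7)) / nstar - μ * Ψ 3 = 0 at e3
  change α * Ψ 3 * (Ψ 1 + (1 - pI) * (Ψ 4 + Ψ 7)) / nstar - (r + μ) * Ψ 4 = 0 at e4
  change ε₂ * Λ - α * (1 - pS) * Ψ 6 * (Ψ 1 + (1 - pI) * (Ψ 4 + Ψ 7)) / nstar - μ * Ψ 6 = 0 at e6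
  change α * (1 - pS) * Ψ 6 * (Ψ 1 + (1 - pI) * (Ψ 4 + Ψ 7)) / nstar - (r + μ) * Ψ 7 = 0 at e7
  have hrm : 0 < r + μ := by linarith
  have hq : 0 < 1 - pI := by linarith [hpI.2]
  have hs : 0 < 1 - pS := by linarith [hpS.2]
  have hn : 0 < nstar := by rw [hnstar]; positivity
  have hΛn : Λ = nstar * μ := by rw [hnstar]; field_simp
  obtain ⟨Y, hY⟩ : ∃ Y, Y = Ψ 1 + (1 - pI) * (Ψ 4 + Ψ 7) := ⟨_, rfl⟩
  rw [← hY] at e0 e1 e3 e4 e6 e7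
  have hYp : 0 < Y := by rw [hY]; positivity
  have b0 : Ψ 0 < ε₀ * nstar := by
    have := mul_pos hrm h1
    refine lt_of_mul_lt_mul_left (a := μ) ?_ hμ.le
    rw [hΛn] at e0; nlinarith
  have b3 : Ψ 3 < ε₁ * nstar := by
    have := mul_pos hrm h4
    refine lt_of_mul_lt_mul_left (a := μ) ?_ hμ.le
    rw [hΛn] at e3; nlinarith
  have b6 : Ψ 6 < ε₂ * nstar := by
    have := mul_pos hrm h7
    refine lt_of_mul_lt_mul_left (a := μ) ?_ hμ.le
    rw [hΛn] at e6; nlinarith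
  have hE : α * (ε₀ + (1 - pI) * ε₁ + (1 - pS) * (1 - pI) * ε₂) < r + μ := by
    rw [hR₀, div_mul_eq_mul_div, div_lt_one hrm] at hR₀lt
    exact hR₀lt
  have key : (r + μ) * Y =
      α * (Y / nstar) * (Ψ 0 + (1 - pI) * Ψ 3 + (1 - pS) * (1 - pI) * Ψ 6) := by
    have : (r + μ) * Y = (r + μ) * Ψ 1 + (1 - pI) * ((r + μ) * Ψ 4 + (r + μ) * Ψ 7) := by
      rw [hY]; ring
    rw [this, ← sub_eq_zero.mp e1, ← sub_eq_zero.mp e4, ← sub_eq_zero.mp e7]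
    ring
  have lt1 : Ψ 0 + (1 - pI) * Ψ 3 + (1 - pS) * (1 - pI) * Ψ 6 <
      ε₀ * nstar + (1 - pI) * (ε₁ * nstar) + (1 - pS) * (1 - pI) * (ε₂ * nstar) := by
    gcongr
  have lt2 := mul_lt_mul_of_pos_left lt1 (show 0 < α * (Y / nstar) by positivity)
  have e : α * (Y / nstar) *
      (ε₀ * nstar + (1 - pI) * (ε₁ * nstar) + (1 - pS) * (1 - pI) * (ε₂ * nstar)) =
      α * (ε₀ + (1 - pI) * ε₁ + (1 - pS) * (1 - pI) * ε₂) * Y := by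
    field_simp
  have lt3 := mul_lt_mul_of_pos_right hE hYp
  linarith
end
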